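/- arXiv:1005.5591 — 2 statements merged into one kernel-verified Lean document; each statement's English description precedes it below -/
import Mathlib

section
/- (Lemma 1) Let σ : {x₁,…,x_n} → {T,F} be a truth assignment and π_σ = ∏_{i : σ(x_i)=T} g_i ∘ ∏_{i : σ(x_i)=F} g′_i the corresponding element of H. If σ NAE-satisfies φ (in every clause not all three literals receive the same truth value), then w(π_σ) = 6; if σ does not NAE-satisfy φ, then w(π_σ) = 7. -/
/- ### The reduction from NAESAT: gadgets and generators.

A 3-CNF formula with `m` clauses over `n` variables is represented by
`φ : Fin m → Fin 3 → Fin n × Bool`: the `k`-th literal of clause `c_j` is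
`φ j k = (i, pos)`, meaning `x_{i+1}` if `pos = true` and `¬x_{i+1}` if `pos = false`
(variable indices are zero-based here: `i : Fin n` stands for the variable `x_{i+1}`).
All permutations act on `ℕ`, supported on the symbols `{1,…,N}` with `N = 48m+18n`. -/

/-- The Chebyshev weight of a permutation of `{1,…,N}` (represented as a permutation
of `ℕ` supported on `{1,…,N}`): `w(π) = max_{i∈{1,…,N}} |π(i) − i|`. -/
def chebWeight (N : ℕ) (π : Equiv.Perm ℕ) : ℕ :=
  (Finset.Icc 1 N).sup fun i => Nat.dist (π i) i

/-- The product of the disjoint transpositions `(r+a, r+b)` over the pairs `(a,b)`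
in the list (i.e. the shift by `r` of the product of the transpositions `(a,b)`). -/
def swapsAt (r : ℕ) (l : List (ℕ × ℕ)) : Equiv.Perm ℕ :=
  (l.map fun p => Equiv.swap (r + p.1) (r + p.2)).prod

/-- `hPerm r k` is `s_r(h_{k+1})` for `k : Fin 3`. -/
def hPerm (r : ℕ) : Fin 3 → Equiv.Perm ℕ
  | 0 => swapsAt r [(1,3),(5,7),(2,4),(6,8),(9,13),(11,15),(10,14),(12,16),(17,23),(19,21),(18,24),(20,22)]
  | 1 => swapsAt r [(1,5),(3,7),(2,6),(4,8),(9,15),(11,13),(10,16),(12,14),(17,19),(21,23),(18,20),(22,24)]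
  | 2 => swapsAt r [(1,7),(3,5),(2,8),(4,6),(9,11),(13,15),(10,12),(14,16),(17,21),(19,23),(18,22),(20,24)]

/-- `gPerm r` is `s_r(g)`. -/
def gPerm (r : ℕ) : Equiv.Perm ℕ :=
  swapsAt r [(1,8),(2,7),(3,6),(4,5),(9,16),(10,15),(11,14),(12,13),(17,24),(18,23),(19,22),(20,21)]

/-- The clause gadget `h_{j+1,k+1,t}` for the zero-based clause index `j` and literal
position `k : Fin 3`: `h_{j,k,T} = s_{48(j−1)}(g∘h_k)` and
`h_{j,k,F} = s_{48(j−1)+24}(g∘h_k)` (with 1-based `j` in the paper's notation). -/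
def clauseGadget (j : ℕ) (k : Fin 3) (t : Bool) : Equiv.Perm ℕ :=
  gPerm (48 * j + if t then 0 else 24) * hPerm (48 * j + if t then 0 else 24) k

/-- The variable gadget `v_{i+1,t}` for the zero-based variable index `i`:
`v_{i,T} = s_{48m−10+10i}(v_T)` and `v_{i,F} = s_{48m−10+10i}(v_F)` (1-based `i`),
where `v_T = (1,4)(7,10)` and `v_F = (1,7)(4,10)`. -/
def varGadget (m i : ℕ) (t : Bool) : Equiv.Perm ℕ :=
  if t then swapsAt (48 * m + 10 * i) [(1,4),(7,10)]
  else swapsAt (48 * m + 10 * i) [(1,7),(4,10)]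

/-- The assignment gadget `u_{i+1}` for the zero-based variable index `i`, with
`b₂ = 48m+10n`: `u_i = (b₂+8(i−1)+1, b₂+8(i−1)+8)(b₂+8i+1, b₂+8i+8)` for `1 ≤ i < n`
and `u_n = (b₂+8(n−1)+1, b₂+8(n−1)+8)(b₂+1, b₂+8)` (1-based `i`). -/
def assignGadget (m n i : ℕ) : Equiv.Perm ℕ :=
  Equiv.swap (48 * m + 10 * n + 8 * i + 1) (48 * m + 10 * n + 8 * i + 8) *
  Equiv.swap (48 * m + 10 * n + 8 * ((i + 1) % n) + 1) (48 * m + 10 * n + 8 * ((i + 1) % n) + 8)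

/-- The generator `g_{i+1}` (when `b = true`) resp. `g'_{i+1}` (when `b = false`):
`g_i = v_{i,T} ∘ u_i ∘ ∏_{(i,j,k)∈P} h_{j,k,T} ∘ ∏_{(i,j,k)∈Q} h_{j,k,F}` and
`g'_i = v_{i,F} ∘ u_i ∘ ∏_{(i,j,k)∈P} h_{j,k,F} ∘ ∏_{(i,j,k)∈Q} h_{j,k,T}`,
where `P` (resp. `Q`) is the set of `(i,j,k)` such that `x_i` (resp. `¬x_i`) is the
`k`-th literal of `c_j`.  (All clause gadgets commute, so the product over the
occurrences of the variable may be taken in order of `(j,k)`.) -/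
def gen (n m : ℕ) (φ : Fin m → Fin 3 → Fin n × Bool) (i : Fin n) (b : Bool) :
    Equiv.Perm ℕ :=
  varGadget m (i : ℕ) b * assignGadget m n (i : ℕ) *
    ((List.finRange m).map fun j =>
      ((List.finRange 3).map fun k =>
        if (φ j k).1 = i then clauseGadget (j : ℕ) k ((φ j k).2 == b) else 1).prod).prod

/-- The subgroup `H` of `S_N` generated by `{g_i, g'_i : i ∈ [n]}`. -/
def Hgroup (n m : ℕ) (φ : Fin m → Fin 3 → Fin n × Bool) : Subgroup (Equiv.Perm ℕ) :=
  Subgroup.closure (Set.range fun p : Fin n × Bool => gen n m φ p.1 p.2)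

/-- The element `π_σ = ∏_{i : σ(x_i)=T} g_i ∘ ∏_{i : σ(x_i)=F} g'_i` of `H`
corresponding to a truth assignment `σ` (where `σ i = true` means `x_{i+1} = T`). -/
def piSigma (n m : ℕ) (φ : Fin m → Fin 3 → Fin n × Bool) (σ : Fin n → Bool) :
    Equiv.Perm ℕ :=
  (((List.finRange n).filter fun i => σ i).map fun i => gen n m φ i true).prod *
  (((List.finRange n).filter fun i => !σ i).map fun i => gen n m φ i false).prod

/-- `σ` NAE-satisfies `φ`: in every clause, not all three literals receive the same
truth value under `σ` (the literal `(v, pos)` is true under `σ` iff `σ v = pos`). -/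
def NAESat (n m : ℕ) (φ : Fin m → Fin 3 → Fin n × Bool) (σ : Fin n → Bool) : Prop :=
  ∀ j : Fin m, ∃ k k' : Fin 3,
    (σ (φ j k).1 == (φ j k).2) ≠ (σ (φ j k').1 == (φ j k').2)

/-- `f` acts on the family of points `p` as the translation of the index by `v`. -/
def Translates {V : Type*} [AddCommMonoid V] (p : V → ℕ) (f : Equiv.Perm ℕ) (v : V) : Prop :=
  ∀ y, f (p y) = p (y + v)

namespace Translates

variable {V : Type*} [AddCommMonoid V] {p : V → ℕ}

theorem of_fixed {f : Equiv.Perm ℕ} (h : ∀ y, f (p y) = p y) : Translates p f 0 := fun y => by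
  rw [h, add_zero]

theorem one : Translates p 1 0 := of_fixed fun _ => rfl

theorem mul {f g : Equiv.Perm ℕ} {v w : V} (hf : Translates p f v) (hg : Translates p g w) :
    Translates p (f * g) (v + w) := fun y => by
  rw [Equiv.Perm.mul_apply, hg, hf, add_assoc, add_comm w]

theorem list_prod {ι : Type*} (l : List ι) {f : ι → Equiv.Perm ℕ} {v : ι → V}
    (h : ∀ i ∈ l, Translates p (f i) (v i)) :
    Translates p (l.map f).prod (l.map v).sum := by
  induction l with
  | nil => exact one
  | cons a l ih =>
    simp only [List.map_cons, List.prod_cons, List.sum_cons]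
    exact (h a (by simp)).mul (ih fun i hi => h i (by simp [hi]))

theorem finRange_prod {n : ℕ} {f : Fin n → Equiv.Perm ℕ} {v : Fin n → V}
    (h : ∀ i, Translates p (f i) (v i)) :
    Translates p ((List.finRange n).map f).prod (∑ i, v i) := by
  rw [Fin.sum_univ_def]
  exact list_prod _ fun i _ => h i

end Translates

theorem swapsAt_apply_of_notMem {r x : ℕ} {l : List (ℕ × ℕ)}
    (h : ∀ p ∈ l, x ≠ r + p.1 ∧ x ≠ r + p.2) : swapsAt r l x = x := by
  induction l with
  | nil => rfl
  | cons a l ih =>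
    have ha := h a (by simp)
    have hl := ih fun p hp => h p (by simp [hp])
    simp only [swapsAt, List.map_cons, List.prod_cons, Equiv.Perm.mul_apply] at hl ⊢
    rw [hl, Equiv.swap_apply_of_ne_of_ne ha.1 ha.2]

theorem swapsAt_add (r x : ℕ) (l : List (ℕ × ℕ)) :
    swapsAt r l (r + x) = r + swapsAt 0 l x := by
  induction l with
  | nil => rfl
  | cons a l ih =>
    simp only [swapsAt, List.map_cons, List.prod_cons, Equiv.Perm.mul_apply] at ih ⊢
    rw [ih]
    simp only [Equiv.swap_apply_def, Nat.zero_add, Nat.add_left_cancel_iff]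
    split_ifs <;> rfl

theorem Translates.swapsAt {V : Type*} [AddCommMonoid V] {q : V → ℕ} {l : List (ℕ × ℕ)} {v : V}
    (h : Translates q (swapsAt 0 l) v) (r : ℕ) :
    Translates (fun y => r + q y) (_root_.swapsAt r l) v := fun y => by
  rw [swapsAt_add, h]

/-- The translation by which a product of generators acts is the sum over its gadgets. -/
theorem translates_piSigma {V : Type*} [AddCommMonoid V] {p : V → ℕ} {n m : ℕ}
    (φ : Fin m → Fin 3 → Fin n × Bool) (σ : Fin n → Bool)
    {u w : Fin n → V} {c : Fin m → Fin 3 → V}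
    (hu : ∀ i : Fin n, Translates p (varGadget m i (σ i)) (u i))
    (hw : ∀ i : Fin n, Translates p (assignGadget m n i) (w i))
    (hc : ∀ (j : Fin m) k, Translates p (clauseGadget j k ((φ j k).2 == σ (φ j k).1)) (c j k)) :
    Translates p (piSigma n m φ σ) (∑ i, u i + ∑ i, w i + ∑ j, ∑ k, c j k) := by
  set v : Fin n → V := fun i => u i + w i + ∑ j, ∑ k, if (φ j k).1 = i then c j k else 0 with hv
  have hgen : ∀ i, Translates p (gen n m φ i (σ i)) (v i) := fun i => by
    refine ((hu i).mul (hw i)).mul (Translates.finRange_prod fun j =>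
      Translates.finRange_prod fun k => ?_)
    split_ifs with h
    · simpa only [h] using hc j k
    · exact Translates.one
  have hsplit : (∑ i, u i + ∑ i, w i + ∑ j, ∑ k, c j k) =
      (((List.finRange n).filter fun i => σ i).map v).sum +
        (((List.finRange n).filter fun i => !σ i).map v).sum := by
    have hl := List.sum_map_filter_add_sum_map_filter_not (fun i => σ i = true) v (List.finRange n)
    simp only [Bool.decide_eq_true, Bool.not_eq_true, Bool.decide_eq_false] at hl
    rw [hl, ← Fin.sum_univ_def, hv]
    simp only [Finset.sum_add_distrib]
    congr 1
    symm
    rw [Finset.sum_comm]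
    refine Finset.sum_congr rfl fun j _ => ?_
    rw [Finset.sum_comm]
    simp
  rw [hsplit]
  refine (Translates.list_prod _ fun i hi => ?_).mul (Translates.list_prod _ fun i hi => ?_)
  · simpa [(List.mem_filter.1 hi).2] using hgen i
  · have : σ i = false := by simpa using (List.mem_filter.1 hi).2
    simpa [this] using hgen i

theorem clauseGadget_apply_of_notMem {j x : ℕ} (k : Fin 3) {t : Bool}
    (h : x ≤ 48 * j + (if t then 0 else 24) ∨ 48 * j + (if t then 0 else 24) + 24 < x) :
    clauseGadget j k t x = x := by
  generalize hr : 48 * j + (if t then 0 else 24) = r at h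
  have hh : hPerm r k x = x := by
    fin_cases k <;> refine swapsAt_apply_of_notMem fun p hp => ?_ <;>
      fin_cases hp <;> dsimp only <;> omega
  have hg : gPerm r x = x := swapsAt_apply_of_notMem fun p hp => by
    fin_cases hp <;> dsimp only <;> omega
  rw [clauseGadget, hr, Equiv.Perm.mul_apply, hh, hg]

theorem varGadget_apply_of_notMem {m i x : ℕ} (t : Bool)
    (h : x ≤ 48 * m + 10 * i ∨ 48 * m + 10 * i + 10 < x) : varGadget m i t x = x := by
  cases t <;> refine swapsAt_apply_of_notMem fun p hp => ?_ <;>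
    fin_cases hp <;> dsimp only <;> omega

theorem assignGadget_apply_of_le {m n i x : ℕ} (h : x ≤ 48 * m + 10 * n) :
    assignGadget m n i x = x := by
  rw [assignGadget]
  generalize (i + 1) % n = i'
  rw [Equiv.Perm.mul_apply,
    Equiv.swap_apply_of_ne_of_ne (x := x) (by omega) (by omega),
    Equiv.swap_apply_of_ne_of_ne (by omega) (by omega)]

/-- The group of three-bit masks. -/
abbrev Mask : Type := ZMod 2 × ZMod 2 × ZMod 2

/-- The points of the `b`-th block of eight of a clause gadget, indexed by their binary digits. -/
def clausePoint (b : Fin 3) (y : Mask) : ℕ :=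
  1 + 8 * b + (4 * y.1.val + 2 * y.2.1.val + y.2.2.val)

/-- The mask by which `g ∘ h_k` acts on the `b`-th block of eight. -/
def clauseMask (b k : Fin 3) : Mask :=
  (1, 1, 1) + ![(0, 1, 0), (1, 0, 0), (1, 1, 0)] (b + k)

/-- The points of a variable gadget: the moved ones are indexed by `y`, the other ones by `s`. -/
def varPoint (s : Fin 10) (y : ZMod 2 × ZMod 2) : ℕ :=
  if 3 ∣ (s : ℕ) then 1 + (6 * y.1.val + 3 * y.2.val) else s + 1

/-- The mask by which a variable gadget acts on its moved points. -/
def varMask (t : Bool) : ZMod 2 × ZMod 2 := if t then (0, 1) else (1, 0)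

/-- The points of an assignment gadget: the moved ones are indexed by `y`, the other ones
by `s`. -/
def assignPoint (s : Fin 8) (y : ZMod 2) : ℕ :=
  if 7 ∣ (s : ℕ) then 1 + 7 * y.val else s + 1

theorem translates_clauseGadget_self (j : ℕ) (b k : Fin 3) (t : Bool) :
    Translates (fun y => 48 * j + (if t then 0 else 24) + clausePoint b y)
      (clauseGadget j k t) (clauseMask b k) := by
  refine Translates.mul (Translates.swapsAt ?_ _) ?_
  · revert b
    unfold Translates
    decide
  · fin_cases k <;> refine Translates.swapsAt ?_ _ <;> revert b <;> unfold Translates <;> decide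

theorem clausePoint_bounds : ∀ b y, 1 ≤ clausePoint b y ∧ clausePoint b y ≤ 24 := by decide

theorem varPoint_bounds : ∀ s y, 1 ≤ varPoint s y ∧ varPoint s y ≤ 10 := by decide

theorem assignPoint_bounds : ∀ s y, 1 ≤ assignPoint s y ∧ assignPoint s y ≤ 8 := by decide

theorem exists_clausePoint {x : ℕ} (hx : x < 24) : ∃ s y, clausePoint s y = x + 1 := by
  have h : ∀ x : Fin 24, ∃ s y, clausePoint s y = x + 1 := by decide
  exact h ⟨x, hx⟩

theorem exists_varPoint {x : ℕ} (hx : x < 10) : ∃ s y, varPoint s y = x + 1 := by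
  have h : ∀ x : Fin 10, ∃ s y, varPoint s y = x + 1 := by decide
  exact h ⟨x, hx⟩

theorem exists_assignPoint {x : ℕ} (hx : x < 8) : ∃ s y, assignPoint s y = x + 1 := by
  have h : ∀ x : Fin 8, ∃ s y, assignPoint s y = x + 1 := by decide
  exact h ⟨x, hx⟩

section Action

variable {n m : ℕ} (φ : Fin m → Fin 3 → Fin n × Bool) (σ : Fin n → Bool)

theorem translates_piSigma_clausePoint (j : Fin m) (t : Bool) (b : Fin 3) :
    Translates (fun y => 48 * j + (if t then 0 else 24) + clausePoint b y) (piSigma n m φ σ)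
      (∑ k, if (σ (φ j k).1 == (φ j k).2) = t then clauseMask b k else 0) := by
  have key := translates_piSigma (p := fun y => 48 * j + (if t then 0 else 24) + clausePoint b y)
    φ σ (u := 0) (w := 0)
    (c := fun j' k => if j' = j then
      if (σ (φ j k).1 == (φ j k).2) = t then clauseMask b k else 0 else 0) ?_ ?_ ?_
  · simpa [Finset.sum_ite_irrel] using key
  · refine fun i => .of_fixed fun y => varGadget_apply_of_notMem _ ?_
    have := clausePoint_bounds b y
    left; split_ifs <;> omega
  · refine fun i => .of_fixed fun y => assignGadget_apply_of_le ?_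
    have := clausePoint_bounds b y
    split_ifs <;> omega
  · intro j' k
    rw [Bool.beq_comm (a := (φ j' k).2)]
    have hb := clausePoint_bounds b
    by_cases hj : j' = j
    · subst hj
      rw [if_pos rfl]
      generalize (σ (φ j' k).1 == (φ j' k).2) = t'
      by_cases ht : t' = t
      · subst ht
        rw [if_pos rfl]
        exact translates_clauseGadget_self j' b k t'
      · rw [if_neg ht]
        refine .of_fixed fun y => clauseGadget_apply_of_notMem _ ?_
        have := hb y
        cases t <;> cases t' <;> simp at ht ⊢ <;> omega
    · rw [if_neg hj]
      refine .of_fixed fun y => clauseGadget_apply_of_notMem _ ?_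
      have := hb y
      have : (j' : ℕ) ≠ j := fun h => hj (Fin.ext h)
      split_ifs <;> omega

theorem translates_piSigma_varPoint (i : Fin n) (s : Fin 10) :
    Translates (fun y => 48 * m + 10 * i + varPoint s y) (piSigma n m φ σ) (varMask (σ i)) := by
  have key := translates_piSigma (p := fun y => 48 * m + 10 * i + varPoint s y) φ σ
    (u := fun i' => if i' = i then varMask (σ i) else 0) (w := 0) (c := 0) ?_ ?_ ?_
  · simpa using key
  · intro i'
    split_ifs with h
    · subst h
      unfold varGadget
      cases σ i' <;> refine Translates.swapsAt ?_ _ <;> revert s <;> unfold Translates <;> decide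
    · refine .of_fixed fun y => varGadget_apply_of_notMem _ ?_
      have := varPoint_bounds s y
      have : (i' : ℕ) ≠ i := fun h' => h (Fin.ext h')
      omega
  · refine fun i' => .of_fixed fun y => assignGadget_apply_of_le ?_
    have := varPoint_bounds s y
    omega
  · refine fun j k => .of_fixed fun y => clauseGadget_apply_of_notMem _ ?_
    have := varPoint_bounds s y
    have := j.2
    right; split_ifs <;> omega

theorem translates_swap_assignPoint (c a a' : ℕ) (s : Fin 8) :
    Translates (fun y => c + 8 * a + assignPoint s y)
      (Equiv.swap (c + 8 * a' + 1) (c + 8 * a' + 8)) (if a' = a then 1 else 0) := by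
  split_ifs with h
  · subst h
    have : Translates (assignPoint s) (swapsAt 0 [(1, 8)]) 1 := by
      revert s; unfold Translates; decide
    simpa [swapsAt] using this.swapsAt (c + 8 * a')
  · refine .of_fixed fun y => Equiv.swap_apply_of_ne_of_ne ?_ ?_ <;>
      have := assignPoint_bounds s y <;> omega

theorem translates_piSigma_assignPoint (i : Fin n) (s : Fin 8) :
    Translates (fun y => 48 * m + 10 * n + 8 * i + assignPoint s y) (piSigma n m φ σ) 0 := by
  have key := translates_piSigma (p := fun y => 48 * m + 10 * n + 8 * i + assignPoint s y) φ σ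
    (u := 0) (w := fun i' => (if (i' : ℕ) = i then 1 else 0) +
      if ((i' : ℕ) + 1) % n = i then 1 else 0) (c := 0) ?_ ?_ ?_
  · have hn : NeZero n := ⟨by have := i.2; omega⟩
    have hrot : ∑ i' : Fin n, (if ((i' : ℕ) + 1) % n = i then (1 : ZMod 2) else 0) =
        ∑ i' : Fin n, if (i' : ℕ) = i then (1 : ZMod 2) else 0 := by
      rw [← Equiv.sum_comp (Equiv.addRight (1 : Fin n)) fun i' => if (i' : ℕ) = i then _ else _]
      simp [Fin.val_add]
    rw [Finset.sum_add_distrib, hrot, CharTwo.add_self_eq_zero] at key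
    simpa using key
  · refine fun i' => .of_fixed fun y => varGadget_apply_of_notMem _ ?_
    have := assignPoint_bounds s y
    omega
  · exact fun i' => (translates_swap_assignPoint _ _ _ s).mul (translates_swap_assignPoint _ _ _ s)
  · refine fun j k => .of_fixed fun y => clauseGadget_apply_of_notMem _ ?_
    have := assignPoint_bounds s y
    have := j.2
    right; split_ifs <;> omega

end Action

/-- The displacement of the point `y` of the `b`-th block of eight of the clause gadget for the
truth value `t`, when the literals of the clause have truth values `a`. -/
def clauseDist (a : Fin 3 → Bool) (t : Bool) (b : Fin 3) (y : Mask) : ℕ :=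
  Nat.dist (clausePoint b (y + ∑ k, if a k = t then clauseMask b k else 0)) (clausePoint b y)

theorem clauseDist_le (a : Fin 3 → Bool) (t : Bool) (b : Fin 3) (y : Mask) :
    clauseDist a t b y ≤ 7 := by
  have h : ∀ b y z, Nat.dist (clausePoint b y) (clausePoint b z) ≤ 7 := by decide
  exact h _ _ _

theorem clauseDist_le_of_ne : ∀ (a : Fin 3 → Bool), (∃ k k', a k ≠ a k') →
    ∀ t b y, clauseDist a t b y ≤ 6 := by
  decide

theorem exists_clauseDist_eq_of_ne : ∀ (a : Fin 3 → Bool), (∃ k k', a k ≠ a k') →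
    ∃ t b y, clauseDist a t b y = 6 := by
  decide

theorem exists_clauseDist_eq : ∀ (a : Fin 3 → Bool), (¬ ∃ k k', a k ≠ a k') →
    ∃ t b y, clauseDist a t b y = 7 := by
  decide

section Weight

variable {n m : ℕ} (φ : Fin m → Fin 3 → Fin n × Bool) (σ : Fin n → Bool)

theorem dist_piSigma_clausePoint (j : Fin m) (t : Bool) (b : Fin 3) (y : Mask) :
    Nat.dist (piSigma n m φ σ (48 * j + (if t then 0 else 24) + clausePoint b y))
      (48 * j + (if t then 0 else 24) + clausePoint b y) =
      clauseDist (fun k => σ (φ j k).1 == (φ j k).2) t b y := by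
  rw [translates_piSigma_clausePoint φ σ j t b y, Nat.dist_add_add_left]
  rfl

theorem le_chebWeight_piSigma (j : Fin m) (t : Bool) (b : Fin 3) (y : Mask) :
    clauseDist (fun k => σ (φ j k).1 == (φ j k).2) t b y ≤
      chebWeight (48 * m + 18 * n) (piSigma n m φ σ) := by
  rw [← dist_piSigma_clausePoint]
  refine Finset.le_sup (f := fun i => Nat.dist (piSigma n m φ σ i) i) (Finset.mem_Icc.2 ?_)
  have := clausePoint_bounds b y
  split_ifs <;> omega

theorem chebWeight_piSigma_le {d : ℕ} (hd : 6 ≤ d)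
    (h : ∀ j t b y, clauseDist (fun k => σ (φ j k).1 == (φ j k).2) t b y ≤ d) :
    chebWeight (48 * m + 18 * n) (piSigma n m φ σ) ≤ d := by
  refine Finset.sup_le fun x hx => ?_
  obtain ⟨hx1, hxN⟩ := Finset.mem_Icc.1 hx
  rcases le_or_gt x (48 * m) with hc | hc
  · obtain ⟨b, y, hy⟩ := exists_clausePoint (x := (x - 1) % 24) (by omega)
    have hpoint : x = 48 * ((x - 1) / 48) +
        (if decide ((x - 1) % 48 < 24) then 0 else 24) + clausePoint b y := by
      simp only [decide_eq_true_eq]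
      split_ifs <;> omega
    have := dist_piSigma_clausePoint φ σ ⟨(x - 1) / 48, by omega⟩ (decide ((x - 1) % 48 < 24)) b y
    rw [← hpoint] at this
    exact this.trans_le (h _ _ _ _)
  rcases le_or_gt x (48 * m + 10 * n) with hv | hv
  · obtain ⟨s, y, hy⟩ := exists_varPoint (x := (x - 48 * m - 1) % 10) (by omega)
    have hpoint : x = 48 * m + 10 * ((x - 48 * m - 1) / 10) + varPoint s y := by
      rw [hy]; omega
    have := translates_piSigma_varPoint φ σ ⟨(x - 48 * m - 1) / 10, by omega⟩ s y
    dsimp only at this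
    rw [← hpoint] at this
    have hle : ∀ t s y, Nat.dist (varPoint s (y + varMask t)) (varPoint s y) ≤ 6 := by decide
    rw [this]
    conv_lhs => arg 2; rw [hpoint]
    rw [Nat.dist_add_add_left]
    exact (hle _ _ _).trans hd
  · obtain ⟨s, y, hy⟩ := exists_assignPoint (x := (x - 48 * m - 10 * n - 1) % 8) (by omega)
    have hpoint : x = 48 * m + 10 * n + 8 * ((x - 48 * m - 10 * n - 1) / 8) +
        assignPoint s y := by
      rw [hy]; omega
    have := translates_piSigma_assignPoint φ σ ⟨(x - 48 * m - 10 * n - 1) / 8, by omega⟩ s y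
    dsimp only at this
    rw [add_zero, ← hpoint] at this
    rw [this, Nat.dist_self]
    exact Nat.zero_le _

end Weight

/-- (Lemma 1) If `σ` NAE-satisfies `φ` then `w(π_σ) = 6`; if `σ` does not
NAE-satisfy `φ` then `w(π_σ) = 7`. -/
theorem weight_piSigma (n m : ℕ) (hn : 1 ≤ n) (hm : 1 ≤ m)
    (φ : Fin m → Fin 3 → Fin n × Bool) (σ : Fin n → Bool) :
    (NAESat n m φ σ → chebWeight (48 * m + 18 * n) (piSigma n m φ σ) = 6) ∧
    (¬ NAESat n m φ σ → chebWeight (48 * m + 18 * n) (piSigma n m φ σ) = 7) := by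
  refine ⟨fun hsat => le_antisymm ?_ ?_, fun hsat => le_antisymm ?_ ?_⟩
  · exact chebWeight_piSigma_le φ σ le_rfl fun j => clauseDist_le_of_ne _ (hsat j)
  · obtain ⟨t, b, y, h⟩ := exists_clauseDist_eq_of_ne _ (hsat ⟨0, hm⟩)
    exact h.ge.trans (le_chebWeight_piSigma φ σ _ t b y)
  · exact chebWeight_piSigma_le φ σ (by norm_num) fun j => clauseDist_le _
  · obtain ⟨j, hj⟩ := not_forall.1 hsat
    obtain ⟨t, b, y, h⟩ := exists_clauseDist_eq _ hj
    exact h.ge.trans (le_chebWeight_piSigma φ σ j t b y)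
end

section
/- (Lemma 2) Every element π of H other than the identity and other than the permutations π_σ arising from truth assignments has Chebyshev weight at least 7: if π ∈ H, π ≠ e, and there is no assignment σ : {x₁,…,x_n} → {T,F} with π = π_σ = ∏_{i : σ(x_i)=T} g_i ∘ ∏_{i : σ(x_i)=F} g′_i, then w(π) ≥ 7. -/
/-! ### Commuting involutions -/

theorem closure_commute_of_commute {G : Type*} [Group G] {S : Set G}
    (hc : ∀ x ∈ S, ∀ y ∈ S, Commute x y) {x y : G}
    (hx : x ∈ Subgroup.closure S) (hy : y ∈ Subgroup.closure S) : Commute x y := by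
  induction hx, hy using Subgroup.closure_induction₂ with
  | mem x y hx hy => exact hc x hx y hy
  | one_left x hx => exact Commute.one_left x
  | one_right x hx => exact Commute.one_right x
  | mul_left x y z hx hy hz h₁ h₂ => exact h₁.mul_left h₂
  | mul_right y z x hy hz hx h₁ h₂ => exact h₁.mul_right h₂
  | inv_left x y hx hy h => exact h.inv_left
  | inv_right x y hx hy h => exact h.inv_right

theorem closure_mul_self_of_commute {G : Type*} [Group G] {S : Set G}
    (hc : ∀ x ∈ S, ∀ y ∈ S, Commute x y) (hs : ∀ x ∈ S, x * x = 1) {x : G}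
    (hx : x ∈ Subgroup.closure S) : x * x = 1 := by
  induction hx using Subgroup.closure_induction with
  | mem x hx => exact hs x hx
  | one => exact one_mul 1
  | mul x y hx hy h₁ h₂ =>
    rw [(closure_commute_of_commute hc hy hx).mul_mul_mul_comm, h₁, h₂, one_mul]
  | inv x hx h => rw [← mul_inv_rev, h, inv_one]

theorem exists_noncommProd_of_mem_closure_range {G ι : Type*} [Group G] (f : ι → G)
    (hc : ∀ i j, Commute (f i) (f j)) (hs : ∀ i, f i * f i = 1) {x : G}
    (hx : x ∈ Subgroup.closure (Set.range f)) :
    ∃ (T : Finset ι) (hT : (T : Set ι).Pairwise (Function.onFun Commute f)),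
      x = T.noncommProd f hT := by
  classical
  have hp : ∀ T : Finset ι, (T : Set ι).Pairwise (Function.onFun Commute f) :=
    fun T i _ j _ _ => hc i j
  simp only [hp, exists_true_left]
  have step : ∀ (i : ι) (T : Finset ι), ∃ T' : Finset ι,
      f i * T.noncommProd f (hp T) = T'.noncommProd f (hp T') := by
    intro i T
    by_cases hi : i ∈ T
    · refine ⟨T.erase i, ?_⟩
      rw [← Finset.mul_noncommProd_erase T hi f (hp T), ← mul_assoc, hs,
        one_mul]
    · exact ⟨insert i T, (Finset.noncommProd_insert_of_notMem T i f _ hi).symm⟩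
  induction hx using Subgroup.closure_induction_left with
  | one => exact ⟨∅, rfl⟩
  | mul_left x hx y hy ih =>
    obtain ⟨i, rfl⟩ := hx
    obtain ⟨T, rfl⟩ := ih
    exact step i T
  | inv_mul_cancel x hx y hy ih =>
    obtain ⟨i, rfl⟩ := hx
    obtain ⟨T, rfl⟩ := ih
    rw [inv_eq_of_mul_eq_one_left (hs i)]
    exact step i T

theorem List.prod_filter_mul_prod_filter_not_of_commute {G ι : Type*} [Monoid G]
    (f g : ι → G) (hc : ∀ i j, Commute (f i) (g j)) (σ : ι → Bool) (l : List ι) :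
    ((l.filter fun i => σ i).map f).prod * ((l.filter fun i => !σ i).map g).prod =
      (l.map fun i => if σ i then f i else g i).prod := by
  induction l with
  | nil => simp
  | cons a l ih =>
    cases h : σ a
    · have hcomm : Commute ((l.filter fun i => σ i).map f).prod (g a) := by
        refine Commute.list_prod_left _ _ fun x hx => ?_
        obtain ⟨i, -, rfl⟩ := List.mem_map.1 hx
        exact hc i a
      simp [h, ← ih, ← mul_assoc, hcomm.eq]
    · simp [h, ← ih, mul_assoc]

/-! ### Permutations supported on a block -/

/-- The embedding of `Fin N` onto the block `{r+1,…,r+N}`. -/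
def blockEmb (N r : ℕ) : Fin N ↪ ℕ where
  toFun x := r + 1 + x
  inj' x y h := Fin.ext (by simpa using h)

/-- The permutation of `ℕ` acting on the block `{r+1,…,r+N}` as `f` does on `Fin N`. -/
noncomputable def blockPerm (N r : ℕ) : Equiv.Perm (Fin N) →* Equiv.Perm ℕ :=
  Equiv.Perm.viaEmbeddingHom (blockEmb N r)

theorem blockPerm_apply_of_notMem {N r x : ℕ} (f : Equiv.Perm (Fin N))
    (hx : x ≤ r ∨ r + N < x) : blockPerm N r f x = x := by
  refine Equiv.Perm.viaEmbedding_apply_of_notMem f (blockEmb N r) x ?_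
  rintro ⟨y, rfl⟩
  have := y.isLt
  change r + 1 + y ≤ r ∨ r + N < r + 1 + y at hx
  omega

theorem blockPerm_swap {N r : ℕ} (a b : Fin N) :
    blockPerm N r (Equiv.swap a b) = Equiv.swap (r + 1 + a) (r + 1 + b) := by
  ext x
  by_cases hx : x ∈ Set.range (blockEmb N r)
  · obtain ⟨y, rfl⟩ := hx
    rw [blockPerm, Equiv.Perm.viaEmbeddingHom_apply, Equiv.Perm.viaEmbedding_apply]
    exact (blockEmb N r).injective.map_swap a b y
  · rw [blockPerm, Equiv.Perm.viaEmbeddingHom_apply,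
      Equiv.Perm.viaEmbedding_apply_of_notMem _ _ _ hx, Equiv.swap_apply_of_ne_of_ne]
    · rintro rfl
      exact hx ⟨a, rfl⟩
    · rintro rfl
      exact hx ⟨b, rfl⟩

theorem commute_blockPerm {M N r s : ℕ} (f : Equiv.Perm (Fin M)) (g : Equiv.Perm (Fin N))
    (h : r + M ≤ s ∨ s + N ≤ r) : Commute (blockPerm M r f) (blockPerm N s g) := by
  refine Equiv.Perm.Disjoint.commute fun x => ?_
  by_cases hx : x ≤ r ∨ r + M < x
  · exact Or.inl (blockPerm_apply_of_notMem f hx)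
  · exact Or.inr (blockPerm_apply_of_notMem g (by omega))

/-- The product of transpositions of `Fin N` given by a list of pairs of one-based positions. -/
def localSwaps (N : ℕ) [NeZero N] (l : List (ℕ × ℕ)) : Equiv.Perm (Fin N) :=
  (l.map fun p => Equiv.swap (Fin.ofNat N (p.1 - 1)) (Fin.ofNat N (p.2 - 1))).prod

theorem swapsAt_eq_blockPerm (N r : ℕ) [NeZero N] (l : List (ℕ × ℕ))
    (hl : ∀ p ∈ l, (1 ≤ p.1 ∧ p.1 ≤ N) ∧ 1 ≤ p.2 ∧ p.2 ≤ N) :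
    swapsAt r l = blockPerm N r (localSwaps N l) := by
  rw [swapsAt, localSwaps, map_list_prod, List.map_map]
  congr 1
  refine List.map_congr_left fun p hp => ?_
  obtain ⟨⟨h₁, h₂⟩, h₃, h₄⟩ := hl p hp
  rw [Function.comp_apply, blockPerm_swap, Fin.val_ofNat, Fin.val_ofNat,
    Nat.mod_eq_of_lt (by omega), Nat.mod_eq_of_lt (by omega)]
  congr 1 <;> omega

/-! ### Gadgets as block permutations -/

/-- The permutation `g ∘ h_{k+1}` of the 24 symbols of a clause block. -/
def clauseLocal (k : Fin 3) : Equiv.Perm (Fin 24) :=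
  localSwaps 24 [(1,8),(2,7),(3,6),(4,5),(9,16),(10,15),(11,14),(12,13),(17,24),(18,23),(19,22),(20,21)] *
  localSwaps 24 (match k with
    | 0 => [(1,3),(5,7),(2,4),(6,8),(9,13),(11,15),(10,14),(12,16),(17,23),(19,21),(18,24),(20,22)]
    | 1 => [(1,5),(3,7),(2,6),(4,8),(9,15),(11,13),(10,16),(12,14),(17,19),(21,23),(18,20),(22,24)]
    | 2 => [(1,7),(3,5),(2,8),(4,6),(9,11),(13,15),(10,12),(14,16),(17,21),(19,23),(18,22),(20,24)])

theorem clauseGadget_eq_blockPerm (j : ℕ) (k : Fin 3) (t : Bool) :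
    clauseGadget j k t = blockPerm 24 (48 * j + if t then 0 else 24) (clauseLocal k) := by
  fin_cases k <;>
    simp only [clauseGadget, clauseLocal, map_mul, gPerm, hPerm] <;>
    rw [swapsAt_eq_blockPerm 24 _ _ (by decide), swapsAt_eq_blockPerm 24 _ _ (by decide)]

theorem clauseLocal_commute : ∀ k k' : Fin 3,
    clauseLocal k * clauseLocal k' = clauseLocal k' * clauseLocal k := by
  decide +kernel

theorem clauseLocal_mul_self : ∀ k : Fin 3, clauseLocal k * clauseLocal k = 1 := by
  decide +kernel

/-- The permutation `v_T` (for `true`) or `v_F` (for `false`) of the symbols of a variable block. -/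
def varLocal (t : Bool) : Equiv.Perm (Fin 10) :=
  localSwaps 10 (if t then [(1,4),(7,10)] else [(1,7),(4,10)])

theorem varGadget_eq_blockPerm (m i : ℕ) (t : Bool) :
    varGadget m i t = blockPerm 10 (48 * m + 10 * i) (varLocal t) := by
  cases t
  · exact swapsAt_eq_blockPerm 10 _ _ (by decide)
  · exact swapsAt_eq_blockPerm 10 _ _ (by decide)

theorem varLocal_commute : ∀ t t' : Bool, varLocal t * varLocal t' = varLocal t' * varLocal t := by
  decide

theorem varLocal_mul_self : ∀ t : Bool, varLocal t * varLocal t = 1 := by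
  decide

/-- The transposition of the end points of the block with index `q` in the assignment region. -/
def endSwap (m n q : ℕ) : Equiv.Perm ℕ :=
  Equiv.swap (48 * m + 10 * n + 8 * q + 1) (48 * m + 10 * n + 8 * q + 8)

theorem endSwap_eq_blockPerm (m n q : ℕ) :
    endSwap m n q = blockPerm 8 (48 * m + 10 * n + 8 * q) (Equiv.swap 0 7) := by
  rw [blockPerm_swap]
  rfl

/-- The gadgets from which the generators of `H` are composed. -/
def gadgets (n m : ℕ) : Set (Equiv.Perm ℕ) :=
  {f | (∃ j < m, ∃ k t, clauseGadget j k t = f) ∨ (∃ i < n, ∃ t, varGadget m i t = f) ∨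
    ∃ q, endSwap m n q = f}

theorem gadgets_commute {n m : ℕ} :
    ∀ x ∈ gadgets n m, ∀ y ∈ gadgets n m, Commute x y := by
  rintro x (⟨j, hj, k, t, rfl⟩ | ⟨i, hi, t, rfl⟩ | ⟨q, rfl⟩) y
    (⟨j', hj', k', t', rfl⟩ | ⟨i', hi', t', rfl⟩ | ⟨q', rfl⟩) <;>
  simp only [clauseGadget_eq_blockPerm, varGadget_eq_blockPerm, endSwap_eq_blockPerm]
  · rcases eq_or_ne j j' with rfl | hjj
    · by_cases htt : t = t'
      · subst htt
        exact Commute.map (clauseLocal_commute k k') _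
      · exact commute_blockPerm _ _ (by cases t <;> cases t' <;> simp at htt ⊢)
    · exact commute_blockPerm _ _ (by split_ifs <;> omega)
  · exact commute_blockPerm _ _ (by split_ifs <;> omega)
  · exact commute_blockPerm _ _ (by split_ifs <;> omega)
  · exact commute_blockPerm _ _ (by split_ifs <;> omega)
  · rcases eq_or_ne i i' with rfl | hii
    · exact Commute.map (varLocal_commute t t') _
    · exact commute_blockPerm _ _ (by omega)
  · exact commute_blockPerm _ _ (by omega)
  · exact commute_blockPerm _ _ (by split_ifs <;> omega)
  · exact commute_blockPerm _ _ (by omega)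
  · rcases eq_or_ne q q' with rfl | hqq
    · exact Commute.refl _
    · exact commute_blockPerm _ _ (by omega)

theorem gadgets_mul_self {n m : ℕ} : ∀ x ∈ gadgets n m, x * x = 1 := by
  rintro x (⟨j, hj, k, t, rfl⟩ | ⟨i, hi, t, rfl⟩ | ⟨q, rfl⟩)
  · rw [clauseGadget_eq_blockPerm, ← map_mul, clauseLocal_mul_self, map_one]
  · rw [varGadget_eq_blockPerm, ← map_mul, varLocal_mul_self, map_one]
  · exact Equiv.swap_mul_self _ _

/-! ### The generators -/

section Generators

variable {n m : ℕ} (φ : Fin m → Fin 3 → Fin n × Bool)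

/-- The product of the clause gadgets occurring in the generator `gen n m φ i b`. -/
def clausePart (i : Fin n) (b : Bool) : Equiv.Perm ℕ :=
  ((List.finRange m).map fun j =>
    ((List.finRange 3).map fun k =>
      if (φ j k).1 = i then clauseGadget (j : ℕ) k ((φ j k).2 == b) else 1).prod).prod

theorem gen_eq (i : Fin n) (b : Bool) :
    gen n m φ i b = varGadget m i b * assignGadget m n i * clausePart φ i b := rfl

theorem clausePart_mem {K : Subgroup (Equiv.Perm ℕ)}
    (hK : ∀ j < m, ∀ k t, clauseGadget j k t ∈ K) (i : Fin n) (b : Bool) :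
    clausePart φ i b ∈ K := by
  refine K.list_prod_mem fun x hx => ?_
  obtain ⟨j, -, rfl⟩ := List.mem_map.1 hx
  refine K.list_prod_mem fun x hx => ?_
  obtain ⟨k, -, rfl⟩ := List.mem_map.1 hx
  split_ifs
  · exact hK j j.isLt k _
  · exact K.one_mem

theorem gen_mem_closure (i : Fin n) (b : Bool) :
    gen n m φ i b ∈ Subgroup.closure (gadgets n m) := by
  have hsub : ∀ {f}, f ∈ gadgets n m → f ∈ Subgroup.closure (gadgets n m) :=
    fun h => Subgroup.subset_closure h
  refine mul_mem (mul_mem ?_ (mul_mem ?_ ?_)) (clausePart_mem φ (fun j hj k t => ?_) i b)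
  · exact hsub (Or.inr (Or.inl ⟨i, i.isLt, b, rfl⟩))
  · exact hsub (Or.inr (Or.inr ⟨i, rfl⟩))
  · exact hsub (Or.inr (Or.inr ⟨(i + 1) % n, rfl⟩))
  · exact hsub (Or.inl ⟨j, hj, k, t, rfl⟩)

theorem gen_commute (p q : Fin n × Bool) :
    Commute (gen n m φ p.1 p.2) (gen n m φ q.1 q.2) :=
  closure_commute_of_commute gadgets_commute (gen_mem_closure φ _ _) (gen_mem_closure φ _ _)

theorem gen_mul_self (p : Fin n × Bool) : gen n m φ p.1 p.2 * gen n m φ p.1 p.2 = 1 :=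
  closure_mul_self_of_commute gadgets_commute gadgets_mul_self (gen_mem_closure φ _ _)

theorem clausePart_apply (i : Fin n) (b : Bool) {x : ℕ} (hx : 48 * m < x) :
    clausePart φ i b x = x := by
  refine clausePart_mem φ (K := MulAction.stabilizer (Equiv.Perm ℕ) x) (fun j hj k t => ?_) i b
  rw [MulAction.mem_stabilizer_iff, Equiv.Perm.smul_def, clauseGadget_eq_blockPerm]
  exact blockPerm_apply_of_notMem _ (Or.inr (by split_ifs <;> omega))

theorem gen_apply_of_le (i : Fin n) (b : Bool) {x : ℕ} (hx : 48 * m < x)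
    (hx' : x ≤ 48 * m + 10 * n) : gen n m φ i b x = varGadget m i b x := by
  have h : ∀ q, endSwap m n q x = x := fun q => by
    rw [endSwap_eq_blockPerm]
    exact blockPerm_apply_of_notMem _ (Or.inl (by omega))
  rw [gen_eq, Equiv.Perm.mul_apply, Equiv.Perm.mul_apply, clausePart_apply φ i b hx]
  change varGadget m i b (endSwap m n _ (endSwap m n _ x)) = _
  rw [h, h]

theorem gen_apply_of_ne {i i' : Fin n} (h : i' ≠ i) (b : Bool) :
    gen n m φ i' b (48 * m + 10 * i + 1) = 48 * m + 10 * i + 1 := by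
  have hi := i.isLt
  have hne := Fin.val_ne_of_ne h
  rw [gen_apply_of_le φ i' b (by omega) (by omega), varGadget_eq_blockPerm]
  exact blockPerm_apply_of_notMem _ (by omega)

theorem gen_true_mul_gen_false_apply (i : Fin n) :
    (gen n m φ i true * gen n m φ i false) (48 * m + 10 * i + 1) = 48 * m + 10 * i + 10 := by
  have hi := i.isLt
  have h₁ : varGadget m i false (48 * m + 10 * i + 1) = 48 * m + 10 * i + 7 := by
    simp [varGadget, swapsAt, Equiv.swap_apply_def]
  have h₂ : varGadget m i true (48 * m + 10 * i + 7) = 48 * m + 10 * i + 10 := by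
    simp [varGadget, swapsAt, Equiv.swap_apply_def]
  rw [Equiv.Perm.mul_apply, gen_apply_of_le φ i false (by omega) (by omega), h₁,
    gen_apply_of_le φ i _ (by omega) (by omega), h₂]

theorem gen_apply_of_lt (i : Fin n) (b : Bool) {q : ℕ} :
    gen n m φ i b (48 * m + 10 * n + 8 * q + 1) =
      if (q = i) = (q = (i + 1) % n) then 48 * m + 10 * n + 8 * q + 1
      else 48 * m + 10 * n + 8 * q + 8 := by
  have hi := i.isLt
  have hv : ∀ x, 48 * m + 10 * n < x → varGadget m i b x = x := fun x hx => by
    rw [varGadget_eq_blockPerm]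
    exact blockPerm_apply_of_notMem _ (by omega)
  rw [gen_eq, Equiv.Perm.mul_apply, Equiv.Perm.mul_apply, clausePart_apply φ i b (by omega)]
  have ha : assignGadget m n i (48 * m + 10 * n + 8 * q + 1) =
      if (q = i) = (q = (i + 1) % n) then 48 * m + 10 * n + 8 * q + 1
      else 48 * m + 10 * n + 8 * q + 8 := by
    rw [assignGadget, Equiv.Perm.mul_apply]
    generalize (i + 1 : ℕ) % n = r
    simp only [Equiv.swap_apply_def, eq_iff_iff]
    split_ifs <;> omega
  rw [ha]
  split_ifs <;> exact hv _ (by omega)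

end Generators

theorem le_chebWeight {N : ℕ} {π : Equiv.Perm ℕ} {x c : ℕ} (h₁ : 1 ≤ x) (h₂ : x ≤ N)
    (h : x + c ≤ π x) : c ≤ chebWeight N π := by
  refine le_trans ?_ (Finset.le_sup (f := fun i => Nat.dist (π i) i) (Finset.mem_Icc.2 ⟨h₁, h₂⟩))
  simp only [Nat.dist]
  omega

theorem noncommProd_perm_apply_eq_self {ι : Type*} (f : ι → Equiv.Perm ℕ) (T : Finset ι) (hc)
    {x : ℕ} (h : ∀ i ∈ T, f i x = x) : T.noncommProd f hc x = x :=
  (MulAction.stabilizer (Equiv.Perm ℕ) x).noncommProd_mem hc h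

theorem exists_ne_succ {n : ℕ} {p : ℕ → Prop} {a b : ℕ} (ha : a < n) (hb : b < n)
    (hpa : p a) (hpb : ¬ p b) : ∃ i, i + 1 < n ∧ ¬ (p i ↔ p (i + 1)) := by
  by_contra! h
  have key : ∀ i, i < n → (p 0 ↔ p i) := by
    intro i
    induction i with
    | zero => simp
    | succ i ih => exact fun hi => (ih (by omega)).trans (h i hi)
  exact hpb ((key b hb).1 ((key a ha).2 hpa))

/-- (Lemma 2) Every element of `H` other than the identity and other than the
permutations `π_σ` arising from truth assignments has Chebyshev weight at least `7`. -/
theorem weight_non_assignment (n m : ℕ) (hn : 1 ≤ n) (hm : 1 ≤ m)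
    (φ : Fin m → Fin 3 → Fin n × Bool) (π : Equiv.Perm ℕ)
    (hmem : π ∈ Hgroup n m φ) (hne : π ≠ 1)
    (hna : ¬ ∃ σ : Fin n → Bool, π = piSigma n m φ σ) :
    7 ≤ chebWeight (48 * m + 18 * n) π := by
  classical
  have hc := gen_commute φ
  obtain ⟨T, hp, rfl⟩ := exists_noncommProd_of_mem_closure_range _ hc (gen_mul_self φ) hmem
  have hpair : ∀ T : Finset (Fin n × Bool), (T : Set (Fin n × Bool)).Pairwise
      (Function.onFun Commute fun p : Fin n × Bool => gen n m φ p.1 p.2) :=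
    fun T p _ q _ _ => hc p q
  by_cases hboth : ∃ i, (i, true) ∈ T ∧ (i, false) ∈ T
  · obtain ⟨i, ht, hf⟩ := hboth
    have hi := i.isLt
    refine le_chebWeight (x := 48 * m + 10 * i + 1) (by omega) (by omega) ?_
    rw [← Finset.mul_noncommProd_erase T ht _ hp (hpair _),
      ← Finset.mul_noncommProd_erase (T.erase (i, true)) (a := (i, false)) (by simp [hf])
        _ (hpair _) (hpair _),
      ← mul_assoc, Equiv.Perm.mul_apply, noncommProd_perm_apply_eq_self,
      gen_true_mul_gen_false_apply]
    · dsimp only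
      omega
    · rintro ⟨i', b⟩ h
      refine gen_apply_of_ne φ (fun hii => ?_) b
      subst hii
      cases b <;> simp at h
  push Not at hboth
  by_cases hall : ∀ i, ∃ b, (i, b) ∈ T
  · choose σ hσ using hall
    refine absurd ⟨σ, ?_⟩ hna
    have hT : T = ((List.finRange n).map fun i => (i, σ i)).toFinset := by
      ext ⟨i, b⟩
      have h := hboth i
      have h' := hσ i
      simp only [List.mem_toFinset, List.mem_map, List.mem_finRange, true_and, Prod.mk.injEq,
        exists_eq_left]
      constructor
      · intro hb
        cases hs : σ i <;> cases b <;> simp_all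
      · rintro rfl
        exact h'
    rw [piSigma, List.prod_filter_mul_prod_filter_not_of_commute _ _
      (fun i j => hc (i, true) (j, false))]
    subst hT
    rw [Finset.noncommProd_toFinset _ _ _
      ((List.nodup_finRange n).map fun i j h => (Prod.mk.inj h).1), List.map_map]
    congr 1
    refine List.map_congr_left fun i _ => ?_
    cases h : σ i <;> simp [h]
  · push Not at hall
    obtain ⟨i₀, hi₀⟩ := hall
    have hT : T.Nonempty := by
      rw [Finset.nonempty_iff_ne_empty]
      rintro rfl
      exact hne rfl
    obtain ⟨⟨i₁, b₁⟩, hi₁⟩ := hT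
    obtain ⟨q, hq, hiff⟩ := exists_ne_succ (p := fun q => ∃ h : q < n, ∃ b, (⟨q, h⟩, b) ∈ T)
      i₁.isLt i₀.isLt ⟨i₁.isLt, b₁, hi₁⟩ (fun ⟨_, b, hb⟩ => hi₀ b hb)
    have hmod : ∀ i : Fin n, q + 1 = (i + 1) % n ↔ (i : ℕ) = q := by
      intro i
      have hi := i.isLt
      rcases Nat.lt_or_ge (i + 1 : ℕ) n with h | h
      · rw [Nat.mod_eq_of_lt h]
        omega
      · rw [show (i + 1 : ℕ) = n by omega, Nat.mod_self]
        omega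
    have happly : ∀ (i : Fin n) (b : Bool),
        gen n m φ i b (48 * m + 10 * n + 8 * (q + 1) + 1) =
          if (i : ℕ) = q ∨ (i : ℕ) = q + 1 then 48 * m + 10 * n + 8 * (q + 1) + 8
          else 48 * m + 10 * n + 8 * (q + 1) + 1 := by
      intro i b
      simp only [gen_apply_of_lt, hmod, eq_iff_iff]
      split_ifs <;> omega
    have key : ∃ (i : Fin n) (b : Bool), (i, b) ∈ T ∧ ((i : ℕ) = q ∨ (i : ℕ) = q + 1) ∧
        ∀ (i' : Fin n) (b' : Bool), (i', b') ∈ T → ((i' : ℕ) = q ∨ (i' : ℕ) = q + 1) →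
          i' = i := by
      have hlt : q < n := by omega
      rw [not_iff] at hiff
      by_cases h : ∃ b, ((⟨q, hlt⟩ : Fin n), b) ∈ T
      · obtain ⟨b, hb⟩ := h
        refine ⟨_, b, hb, Or.inl rfl, fun i' b' hT' hi' => Fin.ext ?_⟩
        refine hi'.resolve_right fun h' => ?_
        refine hiff.2 ⟨hq, b', ?_⟩ ⟨hlt, b, hb⟩
        rwa [show (⟨q + 1, hq⟩ : Fin n) = i' from Fin.ext h'.symm]
      · obtain ⟨_, b, hb⟩ := hiff.1 fun ⟨_, hb⟩ => h hb
        refine ⟨_, b, hb, Or.inr rfl, fun i' b' hT' hi' => Fin.ext ?_⟩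
        refine hi'.resolve_left fun h' => h ⟨b', ?_⟩
        rwa [show (⟨q, hlt⟩ : Fin n) = i' from Fin.ext h'.symm]
    obtain ⟨i, b, hib, hi, huniq⟩ := key
    refine le_chebWeight (x := 48 * m + 10 * n + 8 * (q + 1) + 1) (by omega) (by omega) ?_
    rw [← Finset.mul_noncommProd_erase T hib _ hp (hpair _), Equiv.Perm.mul_apply,
      noncommProd_perm_apply_eq_self, happly, if_pos hi]
    · rintro ⟨i', b'⟩ h
      obtain ⟨hne', hT'⟩ := Finset.mem_erase.1 h
      rw [happly, if_neg]
      intro hi'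
      obtain rfl := huniq i' b' hT' hi'
      have := hboth i'
      cases b <;> cases b' <;> simp_all
end
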